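/- (Loomis–Sikorski theorem.) Let L be an orthomodular σ-lattice and let x, y be compatible observables on L, i.e., x(A) and y(B) are compatible elements of L for all Borel sets A, B ⊆ ℝ. Then there exist an observable h on L (a σ-homomorphism from the Borel σ-algebra of ℝ to L) and Borel measurable functions f, g : ℝ → ℝ such that x(A) = h(f⁻¹(A)) and y(A) = h(g⁻¹(A)) for every Borel set A ⊆ ℝ. -/

import Mathlib

/-- A σ-complete orthomodular lattice (σ-OML): a bounded lattice (with distinct
least element `⊥` and greatest element `⊤`) equipped with an orthocomplementation
`compl` satisfying the orthomodular law, in which every countable family of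
elements has a least upper bound. -/
class SigmaOML (L : Type) extends Lattice L, BoundedOrder L where
  compl : L → L
  compl_compl : ∀ a : L, compl (compl a) = a
  sup_compl : ∀ a : L, a ⊔ compl a = ⊤
  compl_antitone : ∀ a b : L, a ≤ b → compl b ≤ compl a
  orthomodular : ∀ a b : L, a ≤ b → b = a ⊔ compl a ⊓ b
  bot_ne_top : (⊥ : L) ≠ ⊤
  exists_countable_lub : ∀ f : ℕ → L, ∃ s : L, IsLUB (Set.range f) s

/-- `a` is orthogonal to `b` (`a ⊥ b`) if `a ≤ b'`. -/
def SigmaOML.Orthogonal {L : Type} [SigmaOML L] (a b : L) : Prop :=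
  a ≤ SigmaOML.compl b

/-- `a` and `b` are compatible (`a ↔ b`) if `a = (a ∧ b) ∨ (a ∧ b')` and
`b = (a ∧ b) ∨ (a' ∧ b)`. -/
def SigmaOML.Compatible {L : Type} [SigmaOML L] (a b : L) : Prop :=
  a = a ⊓ b ⊔ a ⊓ SigmaOML.compl b ∧ b = a ⊓ b ⊔ SigmaOML.compl a ⊓ b

/-- A σ-additive state on a σ-OML `L`: a map `m : L → [0,1]` with `m ⊤ = 1` which is
σ-additive on every at most countable family of pairwise orthogonal elements. -/
structure OMLState (L : Type) [SigmaOML L] where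
  toFun : L → ℝ
  nonneg : ∀ a, 0 ≤ toFun a
  le_one : ∀ a, toFun a ≤ 1
  map_top : toFun ⊤ = 1
  additive : ∀ {ι : Type} [Countable ι] (f : ι → L) (s : L),
    (∀ i j, i ≠ j → SigmaOML.Orthogonal (f i) (f j)) →
    IsLUB (Set.range f) s →
    HasSum (fun i => toFun (f i)) (toFun s)

/-- An s-map on a σ-OML `L`: a map `p : L × L → [0,1]` with `p(⊤,⊤) = 1`, vanishing on
orthogonal pairs, and σ-additive in each variable on at most countable families of
pairwise orthogonal elements. -/
structure OMLSMap (L : Type) [SigmaOML L] where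
  toFun : L → L → ℝ
  nonneg : ∀ a b, 0 ≤ toFun a b
  le_one : ∀ a b, toFun a b ≤ 1
  map_top_top : toFun ⊤ ⊤ = 1
  orthogonal_eq_zero : ∀ a b, SigmaOML.Orthogonal a b → toFun a b = 0
  additive_left : ∀ {ι : Type} [Countable ι] (f : ι → L) (s b : L),
    (∀ i j, i ≠ j → SigmaOML.Orthogonal (f i) (f j)) →
    IsLUB (Set.range f) s →
    HasSum (fun i => toFun (f i) b) (toFun s b)
  additive_right : ∀ {ι : Type} [Countable ι] (f : ι → L) (s b : L),
    (∀ i j, i ≠ j → SigmaOML.Orthogonal (f i) (f j)) →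
    IsLUB (Set.range f) s →
    HasSum (fun i => toFun b (f i)) (toFun b s)

/-- An observable on a σ-OML `L`: a σ-homomorphism `x` from the Borel σ-algebra of `ℝ`
to `L` with `x(ℝ) = ⊤`, `x(ℝ \ A) = x(A)'`, and `x(⋃ᵢ Aᵢ) = ⋁ᵢ x(Aᵢ)` for countable
families of Borel sets. -/
structure OMLObservable (L : Type) [SigmaOML L] where
  toFun : Set ℝ → L
  map_univ : toFun Set.univ = ⊤
  map_compl : ∀ A : Set ℝ, MeasurableSet A → toFun Aᶜ = SigmaOML.compl (toFun A)
  map_iUnion : ∀ A : ℕ → Set ℝ, (∀ i, MeasurableSet (A i)) →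
    IsLUB (Set.range fun i => toFun (A i)) (toFun (⋃ i, A i))

namespace StoneSpace

open Set Filter PrimeSpectrum

variable {B : Type*} [BooleanAlgebra B]

/-- The clopen subset of the Stone space of `B` attached to an element of `B`; the Stone space is
realised as the prime spectrum of the Boolean ring of `B`. -/
def clopen (a : B) : Set (PrimeSpectrum (AsBoolRing B)) :=
  basicOpen (toBoolRing a)

theorem mem_clopen {a : B} {p : PrimeSpectrum (AsBoolRing B)} :
    p ∈ clopen a ↔ toBoolRing a ∉ p.asIdeal :=
  Iff.rfl

theorem isOpen_clopen (a : B) : IsOpen (clopen a) :=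
  isOpen_basicOpen

theorem clopen_top : clopen (⊤ : B) = univ := by
  ext p
  simpa [mem_clopen] using p.asIdeal.ne_top_iff_one.mp p.2.ne_top

theorem clopen_inf (a b : B) : clopen (a ⊓ b) = clopen a ∩ clopen b := by
  simp [clopen, basicOpen_mul]

theorem clopen_compl (a : B) : clopen aᶜ = (clopen a)ᶜ := by
  ext p
  have hmul : toBoolRing a * toBoolRing aᶜ = 0 := by
    rw [← toBoolRing_inf, inf_compl_self, toBoolRing_bot]
  have hadd : toBoolRing a + toBoolRing aᶜ = 1 := by
    rw [← toBoolRing_symmDiff, symmDiff_compl_self, toBoolRing_top]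
  simp only [mem_compl_iff, mem_clopen, not_not]
  constructor
  · intro h
    exact (p.2.mem_or_mem (hmul ▸ p.asIdeal.zero_mem)).resolve_right h
  · intro h h'
    exact p.2.ne_top (p.asIdeal.eq_top_iff_one.mpr (hadd ▸ p.asIdeal.add_mem h h'))

theorem eq_bot_of_clopen_eq_empty {a : B} (h : clopen a = ∅) : a = ⊥ := by
  have h' : basicOpen (toBoolRing a) = ⊥ := TopologicalSpace.Opens.ext h
  obtain ⟨n, hn⟩ := (basicOpen_eq_bot_iff _).mp h'
  have : toBoolRing a = 0 := by
    have := (BooleanRing.isIdempotentElem (toBoolRing a)).pow_succ_eq n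
    rw [← this, pow_succ, hn, zero_mul]
  exact this

theorem le_of_disjoint_clopen_compl {a b : B} (h : Disjoint (clopen a) (clopen bᶜ)) : a ≤ b := by
  rw [← disjoint_compl_right_iff, disjoint_iff]
  apply eq_bot_of_clopen_eq_empty
  rw [clopen_inf]
  exact h.inter_eq

theorem clopen_mono {a b : B} (h : a ≤ b) : clopen a ⊆ clopen b := by
  rw [← inf_eq_left.mpr h, clopen_inf]
  exact inter_subset_right

instance : T2Space (PrimeSpectrum (AsBoolRing B)) where
  t2 p q hpq := by
    obtain ⟨a, ha⟩ : ∃ a : B, ¬ (p ∈ clopen a ↔ q ∈ clopen a) := by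
      by_contra! h
      exact hpq (PrimeSpectrum.ext (Ideal.ext fun r => not_iff_not.mp (h (ofBoolRing r))))
    have hd : Disjoint (clopen a) (clopen aᶜ) := by
      rw [clopen_compl]
      exact disjoint_compl_right
    by_cases hp : p ∈ clopen a
    · refine ⟨_, _, isOpen_clopen a, isOpen_clopen aᶜ, hp, ?_, hd⟩
      rw [clopen_compl]
      exact fun hq => ha (iff_of_true hp hq)
    · refine ⟨_, _, isOpen_clopen aᶜ, isOpen_clopen a, ?_, ?_, hd.symm⟩
      · rwa [clopen_compl]
      · by_contra hq
        exact ha (iff_of_false hp hq)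

theorem le_of_clopen_eventuallyLE {a b : B}
    (h : clopen a ≤ᶠ[residual (PrimeSpectrum (AsBoolRing B))] clopen b) : a ≤ b := by
  apply le_of_disjoint_clopen_compl
  rw [← not_nonempty_iff_eq_empty.trans disjoint_iff_inter_eq_empty.symm]
  intro hne
  obtain ⟨p, ⟨hpa, hpb⟩, hp⟩ := (dense_of_mem_residual h).inter_open_nonempty _
    ((isOpen_clopen a).inter (isOpen_clopen bᶜ)) hne
  rw [clopen_compl] at hpb
  exact hpb (hp hpa)

theorem eq_of_clopen_eventuallyEq {a b : B}
    (h : clopen a =ᶠ[residual (PrimeSpectrum (AsBoolRing B))] clopen b) : a = b :=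
  (le_of_clopen_eventuallyLE h.le).antisymm (le_of_clopen_eventuallyLE h.symm.le)

theorem iUnion_clopen_eventuallyEq {ι : Type*} {f : ι → B} {s : B} (hs : IsLUB (range f) s) :
    ⋃ i, clopen (f i) =ᶠ[residual (PrimeSpectrum (AsBoolRing B))] clopen s := by
  have hsub : ⋃ i, clopen (f i) ⊆ clopen s :=
    iUnion_subset fun i => clopen_mono (hs.1 (mem_range_self i))
  have hdense : Dense ((⋃ i, clopen (f i)) ∪ clopen sᶜ) := by
    rw [isTopologicalBasis_basic_opens.dense_iff]
    rintro _ ⟨r, rfl⟩ hr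
    set c : B := ofBoolRing r
    change (clopen c).Nonempty at hr
    change (clopen c ∩ _).Nonempty
    by_contra hempty
    rw [not_nonempty_iff_eq_empty, ← disjoint_iff_inter_eq_empty, disjoint_union_right,
      disjoint_iUnion_right] at hempty
    have hcs : c ≤ s := le_of_disjoint_clopen_compl hempty.2
    have hsc : s ≤ cᶜ := hs.2 <| by
      rintro _ ⟨i, rfl⟩
      apply le_of_disjoint_clopen_compl
      rw [compl_compl]
      exact (hempty.1 i).symm
    have hc : c = ⊥ := le_compl_self.mp (hcs.trans hsc)
    have : clopen (⊥ : B) = ∅ := by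
      rw [← compl_top, clopen_compl, clopen_top, compl_univ]
    rw [hc, this] at hr
    exact not_nonempty_empty hr
  have hopen : IsOpen ((⋃ i, clopen (f i)) ∪ clopen sᶜ) :=
    (isOpen_iUnion fun i => isOpen_clopen _).union (isOpen_clopen _)
  refine hsub.eventuallyLE.antisymm ?_
  filter_upwards [residual_of_dense_open hopen hdense] with p hp hps
  rw [clopen_compl] at hp
  exact hp.resolve_right (not_not_intro hps)

/-- The σ-algebra of subsets of the Stone space of `B` that agree with a clopen set up to a meagre
set. -/
abbrev almostClopen (hB : ∀ f : ℕ → B, ∃ s, IsLUB (range f) s) :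
    MeasurableSpace (PrimeSpectrum (AsBoolRing B)) where
  MeasurableSet' S := ∃ b : B, S =ᶠ[residual _] clopen b
  measurableSet_empty := ⟨⊥, by
    rw [← compl_top, clopen_compl, clopen_top, compl_univ]
    exact EventuallyEq.rfl⟩
  measurableSet_compl := by
    rintro S ⟨b, hb⟩
    exact ⟨bᶜ, clopen_compl b ▸ hb.compl⟩
  measurableSet_iUnion S hS := by
    choose b hb using hS
    obtain ⟨s, hs⟩ := hB b
    exact ⟨s, (Filter.EventuallyEq.countable_iUnion hb).trans (iUnion_clopen_eventuallyEq hs)⟩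

end StoneSpace

/-- Every σ-complete Boolean algebra is the image of a σ-algebra of sets under a
σ-homomorphism. -/
theorem BooleanAlgebra.exists_surjective_sigmaHom.{u} {B : Type u} [BooleanAlgebra B]
    (hB : ∀ f : ℕ → B, ∃ s, IsLUB (Set.range f) s) :
    ∃ (X : Type u) (_ : MeasurableSpace X) (φ : Set X → B),
      φ Set.univ = ⊤ ∧ (∀ S, MeasurableSet S → φ Sᶜ = (φ S)ᶜ) ∧
      (∀ S : ℕ → Set X, (∀ i, MeasurableSet (S i)) →
        IsLUB (Set.range fun i => φ (S i)) (φ (⋃ i, S i))) ∧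
      ∀ b, ∃ S, MeasurableSet S ∧ φ S = b := by
  classical
  let := StoneSpace.almostClopen hB
  let φ : Set (PrimeSpectrum (AsBoolRing B)) → B := fun S =>
    if h : ∃ b : B, S =ᶠ[residual _] StoneSpace.clopen b then h.choose else ⊥
  have φ_spec : ∀ {S : Set (PrimeSpectrum (AsBoolRing B))} {b : B}, S =ᶠ[residual _] StoneSpace.clopen b → φ S = b := by
    intro S b hb
    have h : ∃ b : B, S =ᶠ[residual _] StoneSpace.clopen b := ⟨b, hb⟩
    simp only [φ, dif_pos h]
    exact StoneSpace.eq_of_clopen_eventuallyEq (h.choose_spec.symm.trans hb)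
  refine ⟨PrimeSpectrum (AsBoolRing B), this, φ, φ_spec ?_, ?_, ?_, fun b => ?_⟩
  · rw [StoneSpace.clopen_top]
    exact Filter.EventuallyEq.rfl
  · rintro S ⟨b, hb⟩
    rw [φ_spec hb]
    exact φ_spec (StoneSpace.clopen_compl b ▸ hb.compl)
  · intro S hS
    choose b hb using hS
    obtain ⟨s, hs⟩ := hB b
    rw [φ_spec ((Filter.EventuallyEq.countable_iUnion hb).trans
      (StoneSpace.iUnion_clopen_eventuallyEq hs))]
    simpa only [φ_spec (hb _)] using hs
  · exact ⟨StoneSpace.clopen b, ⟨b, Filter.EventuallyEq.rfl⟩, φ_spec Filter.EventuallyEq.rfl⟩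

namespace SigmaOML

open Set

variable {L : Type} [SigmaOML L] {a b c s : L}

theorem compl_le_compl_iff : compl a ≤ compl b ↔ b ≤ a :=
  ⟨fun h => by simpa only [compl_compl] using compl_antitone _ _ h, compl_antitone _ _⟩

theorem le_compl_iff : a ≤ compl b ↔ b ≤ compl a := by
  rw [← compl_le_compl_iff, compl_compl]

theorem compl_sup (a b : L) : compl (a ⊔ b) = compl a ⊓ compl b := by
  apply le_antisymm
  · exact le_inf (compl_antitone _ _ le_sup_left) (compl_antitone _ _ le_sup_right)
  · rw [le_compl_iff]
    exact sup_le (le_compl_iff.mp inf_le_left) (le_compl_iff.mp inf_le_right)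

theorem compl_inf (a b : L) : compl (a ⊓ b) = compl a ⊔ compl b := by
  rw [← compl_compl (compl a ⊔ compl b), compl_sup, compl_compl, compl_compl]

theorem inf_compl_le_bot (a : L) : a ⊓ compl a ≤ ⊥ := by
  rw [← compl_le_compl_iff, compl_inf, compl_compl, sup_comm, sup_compl]
  exact le_top

theorem inf_compl_sup_of_le (h : b ≤ a) : a ⊓ (compl a ⊔ b) = b := by
  have := congrArg compl (orthomodular _ _ (compl_antitone _ _ h))
  simpa only [compl_sup, compl_inf, compl_compl] using this.symm

/-- One half of the definition of compatibility suffices. -/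
theorem Compatible.of_eq_sup (h : a = a ⊓ b ⊔ a ⊓ compl b) : Compatible a b := by
  refine ⟨h, ?_⟩
  have hb := orthomodular (a ⊓ b) b inf_le_right
  have hc : compl (a ⊓ b) ⊓ b = compl a ⊓ b := by
    have ha : compl a = compl (a ⊓ b) ⊓ (compl a ⊔ b) := by
      conv_lhs => rw [h]
      rw [compl_sup, compl_inf a (compl b), compl_compl]
    rw [ha, inf_assoc, inf_eq_right.mpr (le_sup_right : b ≤ compl a ⊔ b)]
  rwa [hc] at hb

theorem Compatible.symm (h : Compatible a b) : Compatible b a :=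
  .of_eq_sup <| by
    conv_lhs => rw [h.2]
    rw [inf_comm b a, inf_comm b]

theorem Compatible.compl_right (h : Compatible a b) : Compatible a (compl b) :=
  .of_eq_sup <| by
    conv_lhs => rw [h.1]
    rw [compl_compl, sup_comm]

theorem Compatible.of_le (h : b ≤ a) : Compatible a b :=
  Compatible.symm <| .of_eq_sup <| by
    rw [inf_eq_left.mpr h, eq_comm, sup_eq_left]
    exact inf_le_left

theorem Compatible.of_isLUB {T : Set L} (hs : IsLUB T s) (h : ∀ b ∈ T, Compatible a b) :
    Compatible a s := by
  refine Compatible.symm <| .of_eq_sup <| le_antisymm (hs.2 fun b hb => ?_)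
    (sup_le inf_le_left inf_le_left)
  rw [(h b hb).symm.1]
  exact sup_le_sup (inf_le_inf_right _ (hs.1 hb)) (inf_le_inf_right _ (hs.1 hb))

theorem inf_le_of_isLUB {T : Set L} {u : L} (hs : IsLUB T s) (h : ∀ b ∈ T, Compatible a b)
    (hu : ∀ b ∈ T, a ⊓ b ≤ u) : a ⊓ s ≤ u := by
  have hle : s ≤ compl a ⊔ a ⊓ u := hs.2 fun c hb => by
    rw [(h c hb).2, sup_comm]
    exact sup_le_sup inf_le_left (le_inf inf_le_left (hu c hb))
  calc a ⊓ s ≤ a ⊓ (compl a ⊔ a ⊓ u) := inf_le_inf_left _ hle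
    _ = a ⊓ u := inf_compl_sup_of_le inf_le_left
    _ ≤ u := inf_le_right

theorem Compatible.sup (hb : Compatible a b) (hc : Compatible a c) : Compatible a (b ⊔ c) :=
  .of_isLUB isLUB_pair <| by simp [hb, hc]

theorem Compatible.inf (hb : Compatible a b) (hc : Compatible a c) : Compatible a (b ⊓ c) := by
  simpa only [compl_sup, compl_compl] using (hb.compl_right.sup hc.compl_right).compl_right

theorem Compatible.inf_sup_le (hb : Compatible a b) (hc : Compatible a c) :
    a ⊓ (b ⊔ c) ≤ a ⊓ b ⊔ a ⊓ c :=
  inf_le_of_isLUB isLUB_pair (by simp [hb, hc]) (by simp)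

/-- The elements compatible with every element of a set. -/
def commutant (T : Set L) : Sublattice L where
  carrier := {b | ∀ a ∈ T, Compatible a b}
  supClosed' _ hb _ hc a ha := (hb a ha).sup (hc a ha)
  infClosed' _ hb _ hc a ha := (hb a ha).inf (hc a ha)

theorem isLUB_mem_commutant {T U : Set L} (hs : IsLUB U s) (hU : U ⊆ commutant T) :
    s ∈ commutant T :=
  fun a ha => .of_isLUB hs fun _ hb => hU hb a ha

theorem exists_isLUB_commutant {T : Set L} (f : ℕ → commutant T) :
    ∃ s : commutant T, IsLUB (range f) s ∧ IsLUB (range fun i => (f i : L)) s := by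
  obtain ⟨s, hs⟩ := exists_countable_lub fun i => (f i : L)
  have hmem : s ∈ commutant T :=
    isLUB_mem_commutant hs (range_subset_iff.mpr fun i => (f i).2)
  refine ⟨⟨s, hmem⟩, ⟨?_, fun u hu => hs.2 ?_⟩, hs⟩
  · rintro _ ⟨i, rfl⟩
    exact hs.1 ⟨i, rfl⟩
  · rintro _ ⟨i, rfl⟩
    exact hu ⟨i, rfl⟩

/-- A commutant whose elements are pairwise compatible is a Boolean algebra. -/
abbrev commutantBooleanAlgebra {T : Set L}
    (h : ∀ a ∈ commutant T, ∀ b ∈ commutant T, Compatible a b) :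
    BooleanAlgebra (commutant T) where
  __ := DistribLattice.ofInfSupLe fun a b c : commutant T =>
    (h a a.2 b b.2).inf_sup_le (h a a.2 c c.2)
  compl b := ⟨compl b, fun a ha => (b.2 a ha).compl_right⟩
  top := ⟨⊤, fun _ _ => (Compatible.of_le le_top).symm⟩
  bot := ⟨⊥, fun _ _ => .of_le bot_le⟩
  le_top _ := le_top (α := L)
  bot_le _ := bot_le (α := L)
  inf_compl_le_bot b := inf_compl_le_bot (b : L)
  top_le_sup_compl b := (sup_compl (b : L)).ge

end SigmaOML

/-- A σ-homomorphism from a σ-algebra of sets to a σ-OML. -/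
structure SigmaOML.SigmaHom (X : Type*) [MeasurableSpace X] (L : Type) [SigmaOML L] where
  toFun : Set X → L
  map_univ : toFun Set.univ = ⊤
  map_compl : ∀ S, MeasurableSet S → toFun Sᶜ = SigmaOML.compl (toFun S)
  map_iUnion : ∀ S : ℕ → Set X, (∀ i, MeasurableSet (S i)) →
    IsLUB (Set.range fun i => toFun (S i)) (toFun (⋃ i, S i))

namespace SigmaOML

open Set

variable {L : Type} [SigmaOML L]

/-- A set of pairwise compatible elements lies in the range of a σ-homomorphism on a σ-algebra of
sets. -/
theorem exists_sigmaHom_of_pairwise_compatible {T : Set L}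
    (hT : ∀ a ∈ T, ∀ b ∈ T, Compatible a b) :
    ∃ (X : Type) (_ : MeasurableSpace X) (φ : SigmaHom X L),
      ∀ a ∈ T, ∃ S, MeasurableSet S ∧ φ.toFun S = a := by
  have hsub : T ⊆ commutant T := fun b hb a ha => hT a ha b hb
  have hcomm : ∀ a ∈ commutant (commutant T : Set L), ∀ b ∈ commutant (commutant T : Set L),
      Compatible a b :=
    fun a ha b hb => hb a fun c hc => ha c (hsub hc)
  let := commutantBooleanAlgebra hcomm
  obtain ⟨X, _, φ, huniv, hcompl, hiUnion, hsurj⟩ :=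
    BooleanAlgebra.exists_surjective_sigmaHom (B := commutant (commutant T : Set L))
      fun f => (exists_isLUB_commutant f).imp fun _ => And.left
  refine ⟨X, ‹_›, ⟨fun S => φ S, congrArg Subtype.val huniv,
    fun S hS => congrArg Subtype.val (hcompl S hS), fun S hS => ?_⟩, fun a ha => ?_⟩
  · obtain ⟨s, hs, hs'⟩ := exists_isLUB_commutant fun i => φ (S i)
    rwa [(hiUnion S hS).unique hs]
  · obtain ⟨S, hS, h⟩ := hsurj ⟨a, fun b hb => (hb a ha).symm⟩
    exact ⟨S, hS, congrArg Subtype.val h⟩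

end SigmaOML

namespace OMLObservable

open Set SigmaOML MeasureTheory

variable {L : Type} [SigmaOML L]

theorem compatible (x : OMLObservable L) {A B : Set ℝ} (hA : MeasurableSet A)
    (hB : MeasurableSet B) : Compatible (x.toFun A) (x.toFun B) := by
  have hunion : ∀ {C D : Set ℝ}, MeasurableSet C → MeasurableSet D →
      IsLUB {x.toFun C, x.toFun D} (x.toFun (C ∪ D)) := by
    intro C D hC hD
    have := x.map_iUnion (fun i => if i = 0 then C else D)
      (fun i => by split_ifs <;> assumption)
    convert! this using 1
    · ext a
      simp only [mem_insert_iff, mem_singleton_iff, mem_range]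
      constructor
      · rintro (rfl | rfl)
        exacts [⟨0, by simp⟩, ⟨1, by simp⟩]
      · rintro ⟨i, rfl⟩
        by_cases hi : i = 0 <;> simp [hi]
    · congr 1
      ext t
      simp only [mem_union, mem_iUnion]
      constructor
      · rintro (h | h)
        exacts [⟨0, by simpa⟩, ⟨1, by simpa⟩]
      · rintro ⟨i, h⟩
        by_cases hi : i = 0
        · exact .inl (by simpa [hi] using h)
        · exact .inr (by simpa [hi] using h)
  have hmono : ∀ {C D : Set ℝ}, MeasurableSet C → MeasurableSet D → C ⊆ D →
      x.toFun C ≤ x.toFun D := by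
    intro C D hC hD h
    have := (hunion hC hD).1 (mem_insert _ _)
    rwa [union_eq_self_of_subset_left h] at this
  refine .of_eq_sup (le_antisymm ?_ (sup_le inf_le_left inf_le_left))
  have h := hunion (hA.inter hB) (hA.inter hB.compl)
  rw [← inter_union_distrib_left, union_compl_self, inter_univ] at h
  refine h.2 ?_
  · rintro _ (rfl | rfl)
    · exact le_sup_of_le_left (le_inf (hmono (hA.inter hB) hA inter_subset_left)
        (hmono (hA.inter hB) hB inter_subset_right))
    · rw [← x.map_compl B hB]
      exact le_sup_of_le_right (le_inf (hmono (hA.inter hB.compl) hA inter_subset_left)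
        (hmono (hA.inter hB.compl) hB.compl inter_subset_right))

/-- An observable whose values lie in the range of a σ-homomorphism `φ` is the image under `φ` of a
real measurable function. -/
theorem exists_measurable_preimage {X : Type*} [MeasurableSpace X] (φ : SigmaHom X L)
    (x : OMLObservable L)
    (hx : ∀ A, MeasurableSet A → ∃ S, MeasurableSet S ∧ φ.toFun S = x.toFun A) :
    ∃ f : X → ℝ, Measurable f ∧
      ∀ A, MeasurableSet A → x.toFun A = φ.toFun (f ⁻¹' A) := by
  classical
  let e : ℝ ≃ᵐ (ℕ → Bool) := PolishSpace.measurableEquivNatBoolOfNotCountable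
    (not_countable_iff.mpr inferInstance)
  have hcyl : ∀ n, MeasurableSet {w : ℕ → Bool | w n = true} := fun n =>
    (measurable_pi_apply (X := fun _ => Bool) n) (measurableSet_singleton true)
  choose S hS hφS using fun n => hx (e ⁻¹' {w | w n = true}) (e.measurable (hcyl n))
  let π : X → ℕ → Bool := fun p n => decide (p ∈ S n)
  have hπ : Measurable π := measurable_pi_iff.mpr fun n =>
    measurable_to_bool (by simpa [π, preimage] using hS n)
  have key : ∀ W : Set (ℕ → Bool), MeasurableSet W →
      x.toFun (e ⁻¹' W) = φ.toFun (π ⁻¹' W) := by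
    let G : Set (Set (ℕ → Bool)) := range fun n => {w | w n = true}
    have hle : MeasurableSpace.pi ≤ MeasurableSpace.generateFrom G :=
      iSup_le fun n => (measurable_iff_comap_le (m₁ := MeasurableSpace.generateFrom G)).mp <|
        measurable_to_bool (MeasurableSpace.measurableSet_generateFrom ⟨n, rfl⟩)
    have hmeas : ∀ {W}, MeasurableSet[MeasurableSpace.generateFrom G] W → MeasurableSet W :=
      fun h => MeasurableSpace.generateFrom_le (forall_mem_range.mpr hcyl) _ h
    intro W hW
    replace hW := hle _ hW
    induction W, hW using MeasurableSpace.generateFrom_induction with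
    | hC W hW _ =>
      obtain ⟨n, rfl⟩ := hW
      rw [← hφS n]
      congr 1
      ext p
      simp [π]
    | empty =>
      rw [preimage_empty, preimage_empty, ← compl_univ, x.map_compl _ .univ, x.map_univ,
        ← compl_univ, φ.map_compl _ .univ, φ.map_univ]
    | compl W hW ih =>
      rw [preimage_compl, preimage_compl, x.map_compl _ (e.measurable (hmeas hW)),
        φ.map_compl _ (hπ (hmeas hW)), ih]
    | iUnion W hW ih =>
      rw [preimage_iUnion, preimage_iUnion]
      refine (x.map_iUnion _ fun n => e.measurable (hmeas (hW n))).unique ?_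
      simp_rw [ih]
      exact φ.map_iUnion _ fun n => hπ (hmeas (hW n))
  refine ⟨e.symm ∘ π, e.symm.measurable.comp hπ, fun A hA => ?_⟩
  have := key (e.symm ⁻¹' A) (e.symm.measurable hA)
  rwa [← preimage_comp, e.symm_comp_self, preimage_id] at this

end OMLObservable

/-- Loomis–Sikorski theorem: If `x, y` are compatible observables on a
σ-OML `L` (i.e. `x(A) ↔ y(B)` for all Borel `A, B`), then there exist an observable
(σ-homomorphism) `h` on `L` and Borel measurable functions `f, g : ℝ → ℝ` such that
`x(A) = h(f⁻¹(A))` and `y(A) = h(g⁻¹(A))` for every Borel set `A`. -/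
theorem loomis_sikorski {L : Type} [SigmaOML L] (x y : OMLObservable L)
    (hxy : ∀ A B : Set ℝ, MeasurableSet A → MeasurableSet B →
      SigmaOML.Compatible (x.toFun A) (y.toFun B)) :
    ∃ (h : OMLObservable L) (f g : ℝ → ℝ), Measurable f ∧ Measurable g ∧
      ∀ A : Set ℝ, MeasurableSet A →
        x.toFun A = h.toFun (f ⁻¹' A) ∧ y.toFun A = h.toFun (g ⁻¹' A) := by
  let T : Set L := {a | ∃ A, MeasurableSet A ∧ (x.toFun A = a ∨ y.toFun A = a)}
  have hT : ∀ a ∈ T, ∀ b ∈ T, SigmaOML.Compatible a b := by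
    rintro _ ⟨A, hA, rfl | rfl⟩ _ ⟨B, hB, rfl | rfl⟩
    exacts [x.compatible hA hB, hxy A B hA hB, (hxy B A hB hA).symm, y.compatible hA hB]
  obtain ⟨X, _, φ, hφ⟩ := SigmaOML.exists_sigmaHom_of_pairwise_compatible hT
  obtain ⟨u, hu, hxu⟩ := x.exists_measurable_preimage φ fun A hA => hφ _ ⟨A, hA, .inl rfl⟩
  obtain ⟨v, hv, hyv⟩ := y.exists_measurable_preimage φ fun A hA => hφ _ ⟨A, hA, .inr rfl⟩
  let k : ℝ ≃ᵐ ℝ × ℝ := PolishSpace.measurableEquivOfNotCountable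
    (not_countable_iff.mpr inferInstance) (not_countable_iff.mpr inferInstance)
  let w : X → ℝ := fun p => k.symm (u p, v p)
  have hw : Measurable w := k.symm.measurable.comp (hu.prodMk hv)
  refine ⟨⟨fun S => φ.toFun (w ⁻¹' S), φ.map_univ, fun S hS => φ.map_compl _ (hw hS),
    fun S hS => ?_⟩, fun t => (k t).1, fun t => (k t).2, measurable_fst.comp k.measurable,
    measurable_snd.comp k.measurable, fun A hA => ⟨?_, ?_⟩⟩
  · rw [Set.preimage_iUnion]
    exact φ.map_iUnion _ fun i => hw (hS i)
  · simpa [w, Set.preimage] using hxu A hA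
  · simpa [w, Set.preimage] using hyv A hA
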